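/- Exponential concentration underlying the SLLN for the mean-field approximated triangle density (Theorem 3.5): Assume α > −2 and that g_{α,h} attains its maximum over [0,1] at a unique point u₀* ∈ (0,1). Then for every ε > 0 there exist τ > 0 and N ∈ ℕ such that for all n ≥ N, ℙ̄_{n;α,h}( { m ∈ Γ_n : |m³ − (u₀*)³| ≥ ε } ) ≤ exp(−τ·n²). -/

import Mathlib

open scoped Classical
open Filter MeasureTheory

/-- The edge density `2k/n²` corresponding to `k` edges out of `n(n−1)/2`. -/
noncomputable def mfDensity (n k : ℕ) : ℝ := 2 * k / (n : ℝ) ^ 2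

/-- Mean-field Gibbs weight `𝒩_m · exp(n²((α/6)m³ + (h/2)m))` for `m = 2k/n²`. -/
noncomputable def mfWeight (α h : ℝ) (n k : ℕ) : ℝ :=
  (Nat.choose (n * (n - 1) / 2) k : ℝ) *
    Real.exp ((n : ℝ) ^ 2 * (α / 6 * (mfDensity n k) ^ 3 + h / 2 * mfDensity n k))

/-- Mean-field partition function. -/
noncomputable def mfZ (α h : ℝ) (n : ℕ) : ℝ :=
  ∑ k ∈ Finset.range (n * (n - 1) / 2 + 1), mfWeight α h n k

/-- Expectation of `f(m)` under the mean-field Gibbs measure on edge densities `Γ_n`. -/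
noncomputable def mfExp (α h : ℝ) (n : ℕ) (f : ℝ → ℝ) : ℝ :=
  (∑ k ∈ Finset.range (n * (n - 1) / 2 + 1), f (mfDensity n k) * mfWeight α h n k) /
    mfZ α h n

/-- Probability of the event `{m ∈ Γ_n : m ∈ A}` under the mean-field Gibbs measure. -/
noncomputable def mfProb (α h : ℝ) (n : ℕ) (A : Set ℝ) : ℝ :=
  (∑ k ∈ Finset.range (n * (n - 1) / 2 + 1),
      if mfDensity n k ∈ A then mfWeight α h n k else 0) / mfZ α h n

/-- The energy function `g_{α,h}(u) = (α/6)u³ + (h/2)u − I(u)/2`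
(note `Real.log 0 = 0`, so the boundary convention `I(0)=I(1)=0` is automatic). -/
noncomputable def gFun (α h u : ℝ) : ℝ :=
  α / 6 * u ^ 3 + h / 2 * u - (u * Real.log u + (1 - u) * Real.log (1 - u)) / 2

/-- Twice the number of edges of the complete graph, as a real number. -/
theorem two_mul_cast_triangle (n : ℕ) :
    2 * ((n * (n - 1) / 2 : ℕ) : ℝ) = (n : ℝ) * (n - 1) := by
  rw [← Nat.choose_two_right, Nat.cast_choose_two]
  ring

theorem continuous_gFun (α h : ℝ) : Continuous (gFun α h) := by
  have h₁ : Continuous fun u : ℝ => u * Real.log u := Real.continuous_mul_log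
  have h₂ : Continuous fun u : ℝ => (1 - u) * Real.log (1 - u) :=
    Real.continuous_mul_log.comp (continuous_const.sub continuous_id)
  unfold gFun
  fun_prop

theorem choose_mul_pow_mul_pow_le_one {x : ℝ} (hx₀ : 0 ≤ x) (hx₁ : x ≤ 1) {N k : ℕ} (hk : k ≤ N) :
    (N.choose k : ℝ) * x ^ k * (1 - x) ^ (N - k) ≤ 1 := by
  have hsum := add_pow x (1 - x) N
  rw [add_sub_cancel, one_pow] at hsum
  have hx₁' : 0 ≤ 1 - x := sub_nonneg.2 hx₁
  calc (N.choose k : ℝ) * x ^ k * (1 - x) ^ (N - k)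
      = x ^ k * (1 - x) ^ (N - k) * (N.choose k : ℝ) := by ring
    _ ≤ ∑ k ∈ Finset.range (N + 1), x ^ k * (1 - x) ^ (N - k) * (N.choose k : ℝ) :=
      Finset.single_le_sum (f := fun k => x ^ k * (1 - x) ^ (N - k) * (N.choose k : ℝ))
        (fun i _ => by positivity) (Finset.mem_range.2 (Nat.lt_succ_of_le hk))
    _ = 1 := hsum.symm

theorem mfDensity_mem_Icc {n k : ℕ} (hn : 2 ≤ n) (hk : k ≤ n * (n - 1) / 2) :
    mfDensity n k ∈ Set.Icc (0 : ℝ) 1 := by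
  have hn' : (2 : ℝ) ≤ n := by exact_mod_cast hn
  have hN := two_mul_cast_triangle n
  have hk' : (k : ℝ) ≤ ((n * (n - 1) / 2 : ℕ) : ℝ) := by exact_mod_cast hk
  refine ⟨by unfold mfDensity; positivity, ?_⟩
  unfold mfDensity
  rw [div_le_one (by positivity)]
  nlinarith

theorem mfWeight_pos (α h : ℝ) {n k : ℕ} (hk : k ≤ n * (n - 1) / 2) : 0 < mfWeight α h n k := by
  have : 0 < (n * (n - 1) / 2).choose k := Nat.choose_pos hk
  unfold mfWeight
  positivity

/-- The Gibbs weight of a density is at most `exp (n² g(m))`. -/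
theorem mfWeight_le_exp (α h : ℝ) {n k : ℕ} (hn : 2 ≤ n) (hk : k ≤ n * (n - 1) / 2) :
    mfWeight α h n k ≤ Real.exp ((n : ℝ) ^ 2 * gFun α h (mfDensity n k)) := by
  obtain ⟨hm₀, -⟩ := mfDensity_mem_Icc hn hk
  have hn' : (2 : ℝ) ≤ n := by exact_mod_cast hn
  have hN := two_mul_cast_triangle n
  have hk' : (k : ℝ) ≤ ((n * (n - 1) / 2 : ℕ) : ℝ) := by exact_mod_cast hk
  have hkm : (2 : ℝ) * k = n ^ 2 * mfDensity n k := by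
    unfold mfDensity
    field_simp
  have hm₁ : mfDensity n k < 1 := by
    unfold mfDensity
    rw [div_lt_one (by positivity)]
    nlinarith
  unfold mfWeight
  generalize mfDensity n k = m at *
  rcases Nat.eq_zero_or_pos k with rfl | hkpos
  · have : m = 0 := by
      have : (n : ℝ) ^ 2 ≠ 0 := by positivity
      simpa [this] using hkm.symm
    simp [this, gFun]
  have hmpos : 0 < m := by
    have : (0 : ℝ) < k := by exact_mod_cast hkpos
    by_contra hcon
    nlinarith [sq_nonneg (n : ℝ)]
  have hlog : Real.log (1 - m) ≤ 0 := Real.log_nonpos (by linarith) (by linarith)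
  have hle := choose_mul_pow_mul_pow_le_one hm₀ hm₁.le hk
  have hC : (0 : ℝ) < ((n * (n - 1) / 2).choose k : ℝ) := by exact_mod_cast Nat.choose_pos hk
  have h1m : 0 < 1 - m := by linarith
  rw [← Real.log_nonpos_iff (by positivity), Real.log_mul (by positivity) (by positivity),
    Real.log_mul (by positivity) (by positivity), Real.log_pow, Real.log_pow,
    Nat.cast_sub hk] at hle
  rw [← Real.exp_log hC, ← Real.exp_add, Real.exp_le_exp]
  unfold gFun
  generalize ((n * (n - 1) / 2 : ℕ) : ℝ) = N at *
  have h₁ : (k : ℝ) = n ^ 2 * m / 2 := by linarith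
  have h₂ : N = n * (n - 1) / 2 := by linarith
  rw [h₁, h₂] at hle
  have : (n : ℝ) * Real.log (1 - m) ≤ 0 := mul_nonpos_of_nonneg_of_nonpos (by linarith) hlog
  linarith

/-- Moments of the normalized binomial distribution converge to powers of its parameter. -/
theorem tendsto_sum_bernstein_mul_pow (u : unitInterval) (j : ℕ) :
    Tendsto (fun N : ℕ => ∑ k : Fin (N + 1), bernstein N k u * ((k : ℝ) / N) ^ j) atTop
      (nhds ((u : ℝ) ^ j)) := by
  let f : C(unitInterval, ℝ) := ⟨fun x => (x : ℝ) ^ j, by fun_prop⟩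
  have := ((continuous_eval_const (F := C(unitInterval, ℝ)) u).tendsto f).comp
    (bernsteinApproximation_uniform f)
  refine this.congr fun N => ?_
  simp [bernsteinApproximation.apply, f, bernstein.z]

/-- Jensen's inequality for the binomial distribution bounds the partition function from below. -/
theorem exp_le_mfZ (α h : ℝ) {n : ℕ} (hn : 2 ≤ n) (u : unitInterval) (hu₀ : 0 < (u : ℝ))
    (hu₁ : (u : ℝ) < 1) (b : ℕ → ℝ)
    (hb : ∀ j, b j = ∑ k : Fin (n * (n - 1) / 2 + 1),
      bernstein (n * (n - 1) / 2) k u * ((k : ℝ) / (n * (n - 1) / 2 : ℕ)) ^ j) :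
    Real.exp ((n : ℝ) ^ 2 * (α / 6 * (1 - 1 / (n : ℝ)) ^ 3 * b 3
      + (1 - 1 / (n : ℝ)) * (h / 2 * b 1
        - (b 1 * Real.log u + (1 - b 1) * Real.log (1 - u)) / 2))) ≤ mfZ α h n := by
  have hn' : (2 : ℝ) ≤ n := by exact_mod_cast hn
  have hN := two_mul_cast_triangle n
  unfold mfZ mfWeight mfDensity
  generalize n * (n - 1) / 2 = N at *
  have hNpos : (0 : ℝ) < N := by nlinarith
  have hsum : ∑ k : Fin (N + 1), bernstein N k u = 1 := bernstein.probability N u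
  set r : ℝ := 1 - 1 / (n : ℝ) with hr
  have hNr : (N : ℝ) = n ^ 2 * r / 2 := by
    rw [hr]
    field_simp
    linarith
  let p : ℝ → ℝ := fun x => (n : ℝ) ^ 2 * (α / 6 * r ^ 3 * x ^ 3
    + r * (h / 2 * x - (x * Real.log u + (1 - x) * Real.log (1 - u)) / 2))
  have hmean : ∑ k : Fin (N + 1), bernstein N k u • p ((k : ℝ) / N) =
      (n : ℝ) ^ 2 * (α / 6 * r ^ 3 * b 3
        + r * (h / 2 * b 1 - (b 1 * Real.log u + (1 - b 1) * Real.log (1 - u)) / 2)) := by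
    have hlin : ∀ k : Fin (N + 1), bernstein N k u • p ((k : ℝ) / N) =
        ((n : ℝ) ^ 2 * (α / 6) * r ^ 3) * (bernstein N k u * ((k : ℝ) / N) ^ 3)
        + ((n : ℝ) ^ 2 * r * (h / 2 - (Real.log u - Real.log (1 - u)) / 2))
          * (bernstein N k u * ((k : ℝ) / N) ^ 1)
        - ((n : ℝ) ^ 2 * r * Real.log (1 - u) / 2) * bernstein N k u := by
      intro k
      simp only [p, smul_eq_mul]
      ring
    rw [Finset.sum_congr rfl fun k _ => hlin k, Finset.sum_sub_distrib, Finset.sum_add_distrib,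
      ← Finset.mul_sum, ← Finset.mul_sum, ← Finset.mul_sum, hsum, ← hb, ← hb]
    ring
  have hjensen := convexOn_exp.map_sum_le (t := Finset.univ)
    (w := fun k : Fin (N + 1) => bernstein N k u) (p := fun k => p ((k : ℝ) / N))
    (fun k _ => bernstein_nonneg) hsum (fun _ _ => Set.mem_univ _)
  rw [hmean] at hjensen
  refine hjensen.trans (le_of_eq ?_)
  rw [Finset.sum_range]
  refine Finset.sum_congr rfl fun k _ => ?_
  have hk : (k : ℕ) ≤ N := Nat.le_of_lt_succ k.2
  have h1u : 0 < 1 - (u : ℝ) := by linarith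
  rw [bernstein_apply, smul_eq_mul]
  have hpow₁ : (u : ℝ) ^ (k : ℕ) = Real.exp (k * Real.log u) := by
    rw [Real.exp_nat_mul, Real.exp_log hu₀]
  have hpow₂ : (1 - (u : ℝ)) ^ (N - (k : ℕ)) =
      Real.exp ((N - k : ℕ) * Real.log (1 - u)) := by
    rw [Real.exp_nat_mul, Real.exp_log h1u]
  rw [hpow₁, hpow₂, mul_assoc, mul_assoc, ← Real.exp_add, ← Real.exp_add, Nat.cast_sub hk]
  congr 2
  have hkN : (k : ℝ) / N * N = k := by field_simp
  have hdens : 2 * (k : ℝ) / n ^ 2 = r * ((k : ℝ) / N) := by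
    rw [div_eq_iff (by positivity)]
    nth_rewrite 1 [← hkN]
    nth_rewrite 2 [hNr]
    ring
  rw [hdens]
  nth_rewrite 1 [← hkN]
  nth_rewrite 2 [← hkN]
  simp only [p]
  generalize (k : ℝ) / N = x
  rw [hNr]
  ring

/-- Lower bound for the partition function on the exponential scale. -/
theorem eventually_exp_le_mfZ (α h : ℝ) {u : ℝ} (hu : u ∈ Set.Ioo (0 : ℝ) 1) {c : ℝ}
    (hc : c < gFun α h u) :
    ∀ᶠ n : ℕ in atTop, Real.exp ((n : ℝ) ^ 2 * c) ≤ mfZ α h n := by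
  let v : unitInterval := ⟨u, hu.1.le, hu.2.le⟩
  let b : ℕ → ℕ → ℝ := fun j N =>
    ∑ k : Fin (N + 1), bernstein N k v * ((k : ℝ) / N) ^ j
  have htri : Tendsto (fun n : ℕ => n * (n - 1) / 2) atTop atTop := by
    refine tendsto_atTop_mono' _ ?_ (tendsto_sub_atTop_nat 1)
    filter_upwards [eventually_ge_atTop 2] with n hn
    rw [Nat.le_div_iff_mul_le two_pos, mul_comm]
    exact Nat.mul_le_mul_right _ hn
  have hb : ∀ j, Tendsto (fun n : ℕ => b j (n * (n - 1) / 2)) atTop (nhds (u ^ j)) := fun j =>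
    (tendsto_sum_bernstein_mul_pow v j).comp htri
  have hr : Tendsto (fun n : ℕ => 1 - 1 / (n : ℝ)) atTop (nhds 1) := by
    simpa using tendsto_one_div_atTop_nhds_zero_nat.const_sub (1 : ℝ)
  have hb₁ := hb 1
  rw [pow_one] at hb₁
  have hlim := (((hr.pow 3).const_mul (α / 6)).mul (hb 3)).add
    (hr.mul ((hb₁.const_mul (h / 2)).sub
      (((hb₁.mul_const (Real.log u)).add
        ((hb₁.const_sub 1).mul_const (Real.log (1 - u)))).div_const 2)))
  have hval : α / 6 * 1 ^ 3 * u ^ 3 + 1 * (h / 2 * u -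
      (u * Real.log u + (1 - u) * Real.log (1 - u)) / 2) = gFun α h u := by
    unfold gFun
    ring
  rw [hval] at hlim
  filter_upwards [hlim.eventually (eventually_gt_nhds hc), eventually_ge_atTop 2] with n hlt hn
  refine le_trans ?_ (exp_le_mfZ α h hn v hu.1 hu.2 (fun j => b j (n * (n - 1) / 2))
    fun j => rfl)
  exact Real.exp_le_exp.2 (mul_le_mul_of_nonneg_left hlt.le (sq_nonneg _))

/-- An event on which `g` is bounded by `a` carries Gibbs mass at most `n² exp (n² a) / Z`. -/
theorem mfProb_le (α h : ℝ) {n : ℕ} (hn : 2 ≤ n) {A : Set ℝ} {a : ℝ}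
    (ha : ∀ m ∈ Set.Icc (0 : ℝ) 1 ∩ A, gFun α h m ≤ a) :
    mfProb α h n A ≤ (n : ℝ) ^ 2 * Real.exp ((n : ℝ) ^ 2 * a) / mfZ α h n := by
  have hn' : (2 : ℝ) ≤ n := by exact_mod_cast hn
  have hZ : 0 ≤ mfZ α h n := Finset.sum_nonneg fun k hk =>
    (mfWeight_pos α h (Nat.le_of_lt_succ (Finset.mem_range.1 hk))).le
  refine div_le_div_of_nonneg_right ?_ hZ
  refine (Finset.sum_le_card_nsmul _ _ (Real.exp ((n : ℝ) ^ 2 * a)) fun k hk => ?_).trans ?_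
  · have hk' := Nat.le_of_lt_succ (Finset.mem_range.1 hk)
    split_ifs with hA
    · refine (mfWeight_le_exp α h hn hk').trans (Real.exp_le_exp.2 ?_)
      exact mul_le_mul_of_nonneg_left (ha _ ⟨mfDensity_mem_Icc hn hk', hA⟩) (sq_nonneg _)
    · positivity
  · rw [Finset.card_range, nsmul_eq_mul]
    refine mul_le_mul_of_nonneg_right ?_ (Real.exp_pos _).le
    have hN := two_mul_cast_triangle n
    push_cast
    nlinarith

theorem eventually_sq_le_exp {δ : ℝ} (hδ : 0 < δ) :
    ∀ᶠ n : ℕ in atTop, (n : ℝ) ^ 2 ≤ Real.exp (δ * (n : ℝ) ^ 2) := by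
  have ht : Tendsto (fun n : ℕ => (n : ℝ) ^ 2) atTop atTop :=
    (tendsto_pow_atTop two_ne_zero).comp tendsto_natCast_atTop_atTop
  have := ((isLittleO_pow_exp_pos_mul_atTop 1 hδ).bound one_pos)
  filter_upwards [ht.eventually this] with n hn
  simpa using hn

/-- Exponential concentration underlying the SLLN for the mean-field approximated
triangle density, in the uniqueness regime. -/
theorem meanField_triangle_exponential_concentration_unique_maximizer
    (α h : ℝ) (hα : α > -2) (u₀ : ℝ) (hu₀ : u₀ ∈ Set.Ioo (0 : ℝ) 1)
    (hmax : ∀ u ∈ Set.Icc (0 : ℝ) 1, gFun α h u ≤ gFun α h u₀)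
    (huniq : ∀ u ∈ Set.Icc (0 : ℝ) 1, gFun α h u = gFun α h u₀ → u = u₀) :
    ∀ ε > 0, ∃ τ > 0, ∃ N : ℕ, ∀ n ≥ N,
      mfProb α h n {m : ℝ | ε ≤ |m ^ 3 - u₀ ^ 3|} ≤ Real.exp (-τ * (n : ℝ) ^ 2) := by
  intro ε hε
  let A : Set ℝ := {m : ℝ | ε ≤ |m ^ 3 - u₀ ^ 3|}
  have hA : IsClosed A := isClosed_le continuous_const (by fun_prop)
  obtain ⟨a, ha, hle⟩ : ∃ a < gFun α h u₀, ∀ m ∈ Set.Icc (0 : ℝ) 1 ∩ A, gFun α h m ≤ a := by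
    rcases (Set.Icc (0 : ℝ) 1 ∩ A).eq_empty_or_nonempty with hempty | hne
    · exact ⟨gFun α h u₀ - 1, by linarith, by simp [hempty]⟩
    · obtain ⟨x, hx, hxmax⟩ := (isCompact_Icc.inter_right hA).exists_isMaxOn hne
        (continuous_gFun α h).continuousOn
      refine ⟨gFun α h x, lt_of_le_of_ne (hmax x hx.1) fun heq => ?_, fun m hm => hxmax hm⟩
      have hxA : ε ≤ |x ^ 3 - u₀ ^ 3| := hx.2
      rw [huniq x hx.1 heq, sub_self, abs_zero] at hxA
      linarith
  obtain ⟨δ, hδ⟩ : ∃ δ, gFun α h u₀ - a = 3 * δ := ⟨(gFun α h u₀ - a) / 3, by ring⟩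
  have hδpos : 0 < δ := by linarith
  have hZ := eventually_exp_le_mfZ α h hu₀ (c := a + 2 * δ) (by linarith)
  obtain ⟨N, hN⟩ := eventually_atTop.1
    (hZ.and ((eventually_sq_le_exp hδpos).and (eventually_ge_atTop 2)))
  refine ⟨δ, hδpos, N, fun n hn => ?_⟩
  obtain ⟨hZn, hsq, hn₂⟩ := hN n hn
  refine (mfProb_le α h hn₂ hle).trans ?_
  rw [div_le_iff₀ ((Real.exp_pos _).trans_le hZn)]
  calc (n : ℝ) ^ 2 * Real.exp ((n : ℝ) ^ 2 * a)
      ≤ Real.exp (δ * (n : ℝ) ^ 2) * Real.exp ((n : ℝ) ^ 2 * a) := by gcongr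
    _ = Real.exp (-δ * (n : ℝ) ^ 2) * Real.exp ((n : ℝ) ^ 2 * (a + 2 * δ)) := by
        rw [← Real.exp_add, ← Real.exp_add]
        ring_nf
    _ ≤ Real.exp (-δ * (n : ℝ) ^ 2) * mfZ α h n := by gcongr
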